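/- Let d ≥ 1 and let Λ = Aℤ^d ⊂ ℝ^d be a Bravais lattice with A invertible. Let γ_r ≥ γ > 0 and let γ̃ ∈ (0, γ). Then there exists a constant C > 0, depending only on d, A, γ, γ_r and γ̃, such that for every n ∈ Λ, all radii R₂ > R₁ > 0, and all j, k ∈ Λ_n^{R₁}, the double sum over the annulus satisfies Σ_{p,q ∈ Λ_n^{R₂} \ Λ_n^{R₁}} e^{−γ_r |j−p|} e^{−γ |p−q|} e^{−γ_r |q−k|} ≤ C e^{−γ̃ (2R₁ − |j−n| − |k−n|)}. -/

import Mathlib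

noncomputable section

open scoped BigOperators

/-- The position in `ℝ^d` (with the Euclidean norm) of the lattice site `A m`, `m ∈ ℤ^d`,
of the Bravais lattice `Λ = A ℤ^d`. -/
def latPos {d : ℕ} (A : Matrix (Fin d) (Fin d) ℝ) (m : Fin d → ℤ) :
    EuclideanSpace ℝ (Fin d) :=
  (WithLp.equiv 2 (Fin d → ℝ)).symm (A.mulVec fun i => (m i : ℝ))

theorem latPos_sub {d : ℕ} (A : Matrix (Fin d) (Fin d) ℝ) (m m' : Fin d → ℤ) :
    latPos A (m - m') = latPos A m - latPos A m' := by
  ext i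
  simp [latPos, Matrix.mulVec, dotProduct, mul_sub, Finset.sum_sub_distrib]

/-- For invertible `A`, the `ℓ¹` norm of `m` is controlled by the Euclidean norm of `A m`. -/
theorem exists_sum_abs_le_mul_norm_latPos {d : ℕ} (A : Matrix (Fin d) (Fin d) ℝ)
    (hA : IsUnit A.det) :
    ∃ M : ℝ, 0 < M ∧ ∀ m : Fin d → ℤ, ∑ i, |(m i : ℝ)| ≤ M * ‖latPos A m‖ := by
  refine ⟨1 + ∑ i, ∑ l, |A⁻¹ i l|, by positivity, fun m => ?_⟩
  have hinv : A⁻¹.mulVec (A.mulVec fun i => (m i : ℝ)) = fun i => (m i : ℝ) := by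
    rw [Matrix.mulVec_mulVec, Matrix.nonsing_inv_mul A hA, Matrix.one_mulVec]
  have hrow : ∀ i, |(m i : ℝ)| ≤ (∑ l, |A⁻¹ i l|) * ‖latPos A m‖ := fun i => by
    rw [← congrFun hinv i, Matrix.mulVec, dotProduct, Finset.sum_mul]
    refine le_trans (Finset.abs_sum_le_sum_abs _ _) (Finset.sum_le_sum fun l _ => ?_)
    rw [abs_mul]
    exact mul_le_mul_of_nonneg_left (PiLp.norm_apply_le (latPos A m) l) (abs_nonneg _)
  calc ∑ i, |(m i : ℝ)| ≤ (∑ i, ∑ l, |A⁻¹ i l|) * ‖latPos A m‖ := by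
        rw [Finset.sum_mul]
        exact Finset.sum_le_sum fun i _ => hrow i
    _ ≤ (1 + ∑ i, ∑ l, |A⁻¹ i l|) * ‖latPos A m‖ := by
        gcongr
        linarith

theorem summable_exp_neg_mul_abs_int {η : ℝ} (hη : 0 < η) :
    Summable fun a : ℤ => Real.exp (-η * |(a : ℝ)|) := by
  have h : Summable fun n : ℕ => Real.exp (-η * n) := by
    simpa [mul_comm] using Real.summable_exp_nat_mul_iff.mpr (neg_lt_zero.mpr hη)
  exact Summable.of_nat_of_neg (by simpa using h) (by simpa using h)

/-- Exponentially weighted lattice sums are bounded, uniformly in their centre. -/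
theorem exists_sum_exp_neg_mul_norm_latPos_sub_le {d : ℕ} (A : Matrix (Fin d) (Fin d) ℝ)
    (hA : IsUnit A.det) {δ : ℝ} (hδ : 0 < δ) :
    ∃ K : ℝ, 0 < K ∧ ∀ (S : Finset (Fin d → ℤ)) (j : Fin d → ℤ),
      ∑ p ∈ S, Real.exp (-δ * ‖latPos A j - latPos A p‖) ≤ K := by
  obtain ⟨M, hM, hbound⟩ := exists_sum_abs_le_mul_norm_latPos A hA
  have hsum := summable_exp_neg_mul_abs_int (div_pos hδ hM)
  set f : ℤ → ℝ := fun a => Real.exp (-(δ / M) * |(a : ℝ)|) with hf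
  have hone : ∀ (T : Finset ℤ) (b : ℤ), ∑ a ∈ T, f (b - a) ≤ ∑' a, f a := fun T b => by
    rw [← (Equiv.subLeft b).tsum_eq f]
    exact ((Equiv.subLeft b).summable_iff.mpr hsum).sum_le_tsum T
      fun a _ => (Real.exp_pos _).le
  refine ⟨(∑' a, f a) ^ d, pow_pos (hsum.tsum_pos (fun a => (Real.exp_pos _).le) 0
    (Real.exp_pos _)) d, fun S j => ?_⟩
  have hterm : ∀ p : Fin d → ℤ,
      Real.exp (-δ * ‖latPos A j - latPos A p‖) ≤ ∏ i, f (j i - p i) := fun p => by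
    rw [hf, ← Real.exp_sum, ← Finset.mul_sum, ← latPos_sub]
    refine Real.exp_le_exp.mpr ?_
    have h := mul_le_mul_of_nonneg_left (hbound (j - p)) (div_pos hδ hM).le
    rw [← mul_assoc, div_mul_cancel₀ δ hM.ne'] at h
    simp only [Pi.sub_apply] at h
    linarith
  calc ∑ p ∈ S, Real.exp (-δ * ‖latPos A j - latPos A p‖)
      ≤ ∑ p ∈ S, ∏ i, f (j i - p i) := Finset.sum_le_sum fun p _ => hterm p
    _ ≤ ∑ p ∈ Fintype.piFinset fun i => S.image (· i), ∏ i, f (j i - p i) := by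
        refine Finset.sum_le_sum_of_subset_of_nonneg (fun p hp => ?_)
          fun p _ _ => Finset.prod_nonneg fun i _ => (Real.exp_pos _).le
        exact Fintype.mem_piFinset.mpr fun i => Finset.mem_image_of_mem _ hp
    _ = ∏ i, ∑ a ∈ S.image (· i), f (j i - a) := by
        rw [Finset.prod_univ_sum]
    _ ≤ ∏ _i : Fin d, ∑' a, f a :=
        Finset.prod_le_prod (fun i _ => Finset.sum_nonneg fun a _ => (Real.exp_pos _).le)
          fun i _ => hone _ _
    _ = (∑' a, f a) ^ d := by simp

/-- If `j` lies within `R` of `n` and `p` lies outside, the excess decay rate of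
`exp (-γr * ‖j - p‖)` over `γt` is kept and the rest is bounded through `R - ‖j - n‖`. -/
theorem exp_neg_mul_norm_sub_le {E : Type*} [SeminormedAddCommGroup E] {γr γ γt R : ℝ}
    (hγγr : γ ≤ γr) (hγt : 0 ≤ γt) {j n p : E} (hp : R ≤ ‖p - n‖) :
    Real.exp (-γr * ‖j - p‖) ≤
      Real.exp (-γt * (R - ‖j - n‖)) * Real.exp (-(γ - γt) * ‖j - p‖) := by
  rw [← Real.exp_add]
  refine Real.exp_le_exp.mpr ?_
  have htri : R - ‖j - n‖ ≤ ‖j - p‖ := by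
    have := norm_sub_le_norm_sub_add_norm_sub p j n
    rw [norm_sub_rev p j] at this
    linarith
  nlinarith [mul_le_mul_of_nonneg_left htri hγt,
    mul_le_mul_of_nonneg_right hγγr (norm_nonneg (j - p))]

/-- Annulus double-sum estimate used in the proof of Theorem 3.2: for `j, k` in the inner
region `Λ_n^{R₁}`, the double sum over the annulus `Λ_n^{R₂} \ Λ_n^{R₁}` of
`e^{-γ_r|j-p|} e^{-γ|p-q|} e^{-γ_r|q-k|}` is bounded by
`C e^{-γ̃(2R₁ - |j-n| - |k-n|)}`. Here `S` is the annulus, characterized by its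
membership predicate. -/
theorem annulus_double_sum_decay
    (d : ℕ) (hd : 1 ≤ d) (A : Matrix (Fin d) (Fin d) ℝ) (hA : IsUnit A.det)
    (γr γ γt : ℝ) (hγ : 0 < γ) (hγγr : γ ≤ γr) (hγt : 0 < γt) (hγtlt : γt < γ) :
    ∃ C : ℝ, 0 < C ∧
      ∀ (n : Fin d → ℤ) (R₁ R₂ : ℝ), 0 < R₁ → R₁ < R₂ →
        ∀ S : Finset (Fin d → ℤ),
          (∀ p, p ∈ S ↔ (R₁ < ‖latPos A p - latPos A n‖ ∧ ‖latPos A p - latPos A n‖ ≤ R₂)) →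
          ∀ j k : Fin d → ℤ,
            ‖latPos A j - latPos A n‖ ≤ R₁ → ‖latPos A k - latPos A n‖ ≤ R₁ →
            ∑ p ∈ S, ∑ q ∈ S,
                Real.exp (-γr * ‖latPos A j - latPos A p‖) *
                  Real.exp (-γ * ‖latPos A p - latPos A q‖) *
                    Real.exp (-γr * ‖latPos A q - latPos A k‖) ≤
              C * Real.exp (-γt * (2 * R₁ - ‖latPos A j - latPos A n‖
                  - ‖latPos A k - latPos A n‖)) := by
  obtain ⟨K, hK, hsum⟩ :=
    exists_sum_exp_neg_mul_norm_latPos_sub_le A hA (sub_pos.mpr hγtlt)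
  refine ⟨K * K, mul_pos hK hK, fun n R₁ R₂ _ _ S hS j k _ _ => ?_⟩
  set E : (Fin d → ℤ) → ℝ := fun j => Real.exp (-γt * (R₁ - ‖latPos A j - latPos A n‖)) with hE
  set g : (Fin d → ℤ) → (Fin d → ℤ) → ℝ :=
    fun j p => Real.exp (-(γ - γt) * ‖latPos A j - latPos A p‖) with hg
  have hfactor : ∀ j, ∀ p ∈ S, Real.exp (-γr * ‖latPos A j - latPos A p‖) ≤ E j * g j p :=
    fun j p hp => exp_neg_mul_norm_sub_le hγγr hγt.le ((hS p).mp hp).1.le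
  have hmid : ∀ p q, Real.exp (-γ * ‖latPos A p - latPos A q‖) ≤ 1 := fun p q =>
    Real.exp_le_one_iff.mpr (mul_nonpos_of_nonpos_of_nonneg (by linarith) (norm_nonneg _))
  calc _ ≤ ∑ p ∈ S, ∑ q ∈ S, E j * g j p * 1 * (E k * g k q) := by
        refine Finset.sum_le_sum fun p hp => Finset.sum_le_sum fun q hq => ?_
        rw [norm_sub_rev (latPos A q) (latPos A k)]
        gcongr
        exacts [hfactor j p hp, hmid p q, hfactor k q hq]
    _ = E j * E k * ((∑ p ∈ S, g j p) * ∑ q ∈ S, g k q) := by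
        rw [Finset.sum_mul_sum, Finset.mul_sum]
        refine Finset.sum_congr rfl fun p _ => ?_
        rw [Finset.mul_sum]
        exact Finset.sum_congr rfl fun q _ => by ring
    _ ≤ E j * E k * (K * K) := by
        gcongr
        exacts [hsum S j, hsum S k]
    _ = _ := by
        rw [mul_comm, hE, ← Real.exp_add]
        ring_nf
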